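/- arXiv:2212.13250 — 3 statements merged into one kernel-verified Lean document; each statement's English description precedes it below -/
import Mathlib

section
/- In the decision problem with Θ = A = {1/n : n ∈ ℕ, n ≥ 1}: for every countably additive probability measure π on Θ, the infimum over nonrandomized procedures equals -1, that is, ⨅_{a ∈ A} ∫_Θ ℓ(θ,a) π(dθ) = -1. -/
open MeasureTheory

/-- The parameter space (= action space) `Θ = A = {1/n : n ∈ ℕ, n ≥ 1}`. -/
def Param : Type := {x : ℝ // ∃ n : ℕ, 0 < n ∧ x = 1 / (n : ℝ)}

/-- The real number underlying an element of `Param`. -/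
def Param.toR (p : Param) : ℝ := Subtype.val p

/-- `Param` is a countable discrete measurable space: its σ-algebra is the powerset. -/
instance : MeasurableSpace Param := ⊤

/-- The loss: `ℓ(θ,a) = 1` if `θ < a`, `0` if `θ = a`, `-1` if `θ > a`. -/
noncomputable def loss (θ a : Param) : ℝ :=
  if θ.toR < a.toR then 1 else if θ.toR = a.toR then 0 else -1

open Filter Topology

theorem norm_loss_le_one (θ a : Param) : ‖loss θ a‖ ≤ 1 := by
  unfold loss
  split_ifs <;> simp

theorem integrable_loss (π : Measure Param) [IsProbabilityMeasure π] (a : Param) :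
    Integrable (fun θ => loss θ a) π :=
  Integrable.of_bound (measurable_from_top (f := fun θ => loss θ a)).aestronglyMeasurable 1
    (ae_of_all _ fun θ => norm_loss_le_one θ a)

theorem neg_one_le_integral_loss (π : Measure Param) [IsProbabilityMeasure π] (a : Param) :
    -1 ≤ ∫ θ, loss θ a ∂π := by
  have h := integral_mono (integrable_const (-1 : ℝ)) (integrable_loss π a)
    fun θ => (abs_le.mp (norm_loss_le_one θ a)).1
  simpa using h

/-- The action `1 / (n + 1)`. -/
noncomputable def Param.oneDivSucc (n : ℕ) : Param :=
  ⟨1 / ((n + 1 : ℕ) : ℝ), n + 1, n.succ_pos, rfl⟩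

theorem Param.tendsto_toR_oneDivSucc :
    Tendsto (fun n => (Param.oneDivSucc n).toR) atTop (𝓝 0) := by
  simpa [Param.oneDivSucc, Param.toR] using tendsto_one_div_add_atTop_nhds_zero_nat (𝕜 := ℝ)

theorem Param.toR_pos (p : Param) : 0 < p.toR := by
  obtain ⟨x, n, hn, rfl⟩ := p
  exact one_div_pos.mpr (Nat.cast_pos.mpr hn)

theorem tendsto_loss_oneDivSucc (θ : Param) :
    Tendsto (fun n => loss θ (Param.oneDivSucc n)) atTop (𝓝 (-1)) := by
  refine tendsto_const_nhds.congr' ?_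
  filter_upwards [Param.tendsto_toR_oneDivSucc.eventually_lt_const θ.toR_pos] with n hn
  rw [loss, if_neg hn.not_gt, if_neg hn.ne']

theorem tendsto_integral_loss_oneDivSucc (π : Measure Param) [IsProbabilityMeasure π] :
    Tendsto (fun n => ∫ θ, loss θ (Param.oneDivSucc n) ∂π) atTop (𝓝 (-1)) := by
  have h := tendsto_integral_of_dominated_convergence (μ := π) (fun _ => (1 : ℝ))
    (fun n => (integrable_loss π (Param.oneDivSucc n)).aestronglyMeasurable)
    (integrable_const 1) (fun n => ae_of_all _ fun θ => norm_loss_le_one θ _)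
    (ae_of_all _ tendsto_loss_oneDivSucc)
  simpa using h

/-- For every countably additive prior `π` on `Θ`, the infimum of the Bayes risk over
nonrandomized procedures (single actions `a ∈ A`) equals `-1`. -/
theorem stmt3 (π : Measure Param) (hπ : IsProbabilityMeasure π) :
    (⨅ a : Param, ∫ θ, loss θ a ∂π) = -1 := by
  have : Nonempty Param := ⟨Param.oneDivSucc 0⟩
  have hbdd : BddBelow (Set.range fun a : Param => ∫ θ, loss θ a ∂π) :=
    ⟨-1, Set.forall_mem_range.mpr (neg_one_le_integral_loss π)⟩
  exact le_antisymm
    (ge_of_tendsto' (tendsto_integral_loss_oneDivSucc π) fun n => ciInf_le hbdd _)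
    (le_ciInf (neg_one_le_integral_loss π))
end

section
/- Bayes optimality of minimax procedures on compact parameter spaces: suppose Θ is a nonempty compact metric space with its Borel σ-algebra, inf_{δ ∈ 𝒟} sup_{θ ∈ Θ} r(θ,δ) < ∞, and for every δ ∈ 𝒟 the risk function θ ↦ r(θ,δ) is upper semicontinuous on Θ (into [0,∞]). Then there exists a Borel probability measure π₀ on Θ that is least favorable, i.e., inf_{δ ∈ 𝒟} ∫⁻ r(θ,δ) π₀(dθ) = sup_{π} inf_{δ ∈ 𝒟} ∫⁻ r(θ,δ) π(dθ), and moreover every minimax decision procedure δ₀ (one with sup_{θ} r(θ,δ₀) = inf_{δ ∈ 𝒟} sup_{θ} r(θ,δ)) is Bayes with respect to π₀: ∫⁻ r(θ,δ₀) π₀(dθ) = inf_{δ ∈ 𝒟} ∫⁻ r(θ,δ) π₀(dθ). -/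
open MeasureTheory ProbabilityTheory

/-- The risk of a randomized decision procedure (Markov kernel) `δ` at parameter `θ`:
`r(θ,δ) = ∫_X (∫_A ℓ(θ,a) δ(x)(da)) P_θ(dx)`, valued in `[0,∞]`. -/
noncomputable def risk {Θ X A : Type*} [MeasurableSpace X] [MeasurableSpace A]
    (ℓ : Θ → A → NNReal) (P : Θ → Measure X) (δ : Kernel X A) (θ : Θ) : ENNReal :=
  ∫⁻ x, ∫⁻ a, (ℓ θ a : ENNReal) ∂(δ x) ∂(P θ)

open Filter Topology

/-- A finite-dimensional alternative: if every convex combination of the `r i` exceeds `c`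
somewhere, then some point of the convex hull of the joint range has all coordinates above `c`. -/
lemma exists_mem_convexHull_range_forall_lt {ι T : Type*} [Fintype ι] [Nonempty T]
    (r : ι → T → ℝ) (c : ℝ)
    (h : ∀ l : ι → ℝ, (∀ i, 0 ≤ l i) → ∑ i, l i = 1 → ∃ t, c < ∑ i, l i * r i t) :
    ∃ v ∈ convexHull ℝ (Set.range fun t i => r i t), ∀ i, c < v i := by
  classical
  by_contra! hcon
  have hO : IsOpen {v : ι → ℝ | ∀ i, c < v i} := by
    have : {v : ι → ℝ | ∀ i, c < v i} = ⋂ i, {v | c < v i} := by ext; simp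
    rw [this]
    exact isOpen_iInter_of_finite fun i => isOpen_lt continuous_const (continuous_apply i)
  have hC : Convex ℝ {v : ι → ℝ | ∀ i, c < v i} := by
    have : {v : ι → ℝ | ∀ i, c < v i} = Set.pi Set.univ fun _ => Set.Ioi c := by ext; simp
    rw [this]
    exact convex_pi fun i _ => convex_Ioi c
  obtain ⟨f, u, hf, hu⟩ := geometric_hahn_banach_open hC hO
    (convex_convexHull ℝ (Set.range fun t i => r i t))
    (Set.disjoint_left.2 fun v hv hv' => by
      obtain ⟨i, hi⟩ := hcon v hv'
      exact absurd (hv i) (not_lt.2 hi))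
  have hfv : ∀ v : ι → ℝ, f v = ∑ i, v i * f (Pi.single i 1) := fun v => by
    conv_lhs => rw [← Finset.univ_sum_single v, map_sum]
    refine Finset.sum_congr rfl fun i _ => ?_
    rw [← smul_eq_mul, ← map_smul, ← Pi.single_smul, smul_eq_mul, mul_one]
  have hneg : ∀ i, f (Pi.single i 1) ≤ 0 := by
    intro i
    by_contra! hi
    set w : ι → ℝ := fun _ => c + 1
    set s : ℝ := |u - f w| / f (Pi.single i 1)
    have h1 := hf (w + s • Pi.single i (1 : ℝ)) fun j => by
      have : 0 ≤ (s • Pi.single i (1 : ℝ) : ι → ℝ) j := by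
        have hs : 0 ≤ s := by positivity
        by_cases hj : j = i
        · subst hj; simpa using hs
        · simp [hj]
      simp only [Pi.add_apply, w]
      linarith
    rw [map_add, map_smul, smul_eq_mul, div_mul_cancel₀ _ hi.ne'] at h1
    linarith [le_abs_self (u - f w)]
  have hconst : ∀ e : ℝ, f (fun _ => e) = e * ∑ i, f (Pi.single i 1) := fun e => by
    rw [hfv, Finset.mul_sum]
  have hcu : c * ∑ i, f (Pi.single i 1) ≤ u := by
    have ht : Tendsto (fun e : ℝ => e * ∑ i, f (Pi.single i 1)) (𝓝[>] c)
        (𝓝 (c * ∑ i, f (Pi.single i 1))) :=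
      (Continuous.tendsto (by fun_prop) c).mono_left nhdsWithin_le_nhds
    refine le_of_tendsto ht ?_
    filter_upwards [self_mem_nhdsWithin] with e he
    rw [← hconst]
    exact (hf _ fun _ => he).le
  have hrange : ∀ t, u ≤ ∑ i, r i t * f (Pi.single i 1) := fun t => by
    rw [← hfv]
    exact hu _ (subset_convexHull ℝ _ ⟨t, rfl⟩)
  have hS : ∑ i, f (Pi.single i 1) < 0 := by
    refine lt_of_le_of_ne (Finset.sum_nonpos fun i _ => hneg i) fun h0 => ?_
    have hz : ∀ i, f (Pi.single i 1) = 0 := fun i =>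
      (Finset.sum_eq_zero_iff_of_nonpos fun i _ => hneg i).1 h0 i (Finset.mem_univ i)
    have h1 := hf (fun _ => c + 1) fun _ => lt_add_one c
    have h2 := hrange (Classical.arbitrary T)
    rw [hconst, h0] at h1
    simp only [hz, mul_zero, Finset.sum_const_zero] at h1 h2
    linarith
  set S := ∑ i, f (Pi.single i 1)
  obtain ⟨t, ht⟩ := h (fun i => f (Pi.single i 1) / S)
    (fun i => div_nonneg_of_nonpos (hneg i) hS.le)
    (by rw [← Finset.sum_div]; exact div_self hS.ne)
  have h3 : ∑ i, f (Pi.single i 1) / S * r i t = (∑ i, r i t * f (Pi.single i 1)) / S := by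
    rw [Finset.sum_div]
    exact Finset.sum_congr rfl fun i _ => by ring
  rw [h3, lt_div_iff_of_neg hS] at ht
  linarith [hrange t]

/-- Points in the convex hull of a joint range are dominated by vectors of integrals against
a common probability measure. -/
lemma exists_isProbabilityMeasure_of_mem_convexHull {ι T : Type*} [MeasurableSpace T]
    (r : ι → T → ℝ) (hr : ∀ i, Measurable (r i)) {v : ι → ℝ}
    (hv : v ∈ convexHull ℝ (Set.range fun t i => r i t)) :
    ∃ π : Measure T, IsProbabilityMeasure π ∧
      ∀ i, ENNReal.ofReal (v i) ≤ ∫⁻ t, ENNReal.ofReal (r i t) ∂π := by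
  suffices h : convexHull ℝ (Set.range fun t i => r i t) ⊆
      {v | ∃ π : Measure T, IsProbabilityMeasure π ∧
        ∀ i, ENNReal.ofReal (v i) ≤ ∫⁻ t, ENNReal.ofReal (r i t) ∂π} from h hv
  refine convexHull_min ?_ ?_
  · rintro _ ⟨t, rfl⟩
    exact ⟨Measure.dirac t, inferInstance, fun i => by
      rw [lintegral_dirac' _ (hr i).ennreal_ofReal]⟩
  · rintro x ⟨μ, hμ, hx⟩ y ⟨ν, hν, hy⟩ a b ha hb hab
    refine ⟨ENNReal.ofReal a • μ + ENNReal.ofReal b • ν, ⟨?_⟩, fun i => ?_⟩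
    · simp [← ENNReal.ofReal_add ha hb, hab]
    · rw [lintegral_add_measure, lintegral_smul_measure, lintegral_smul_measure]
      simp only [Pi.add_apply, Pi.smul_apply, smul_eq_mul]
      refine ENNReal.ofReal_add_le.trans ?_
      rw [ENNReal.ofReal_mul ha, ENNReal.ofReal_mul hb]
      gcongr
      · exact hx i
      · exact hy i

/-- On a compact metric space, superlevel sets of the integral of a finite upper semicontinuous
function are weakly closed. -/
lemma isClosed_setOf_le_lintegral_of_upperSemicontinuous {T : Type*} [MetricSpace T]
    [CompactSpace T] [MeasurableSpace T] [BorelSpace T] (r : T → ENNReal)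
    (hr : UpperSemicontinuous r) (hfin : ∀ t, r t < ⊤) (c : ENNReal) :
    IsClosed {π : ProbabilityMeasure T | c ≤ ∫⁻ t, r t ∂(π : Measure T)} := by
  rcases isEmpty_or_nonempty T with hT | hT
  · have : IsEmpty (ProbabilityMeasure T) := ⟨fun π => by
      have := π.nonempty
      exact hT.elim this.some⟩
    exact isClosed_discrete _
  obtain ⟨t₀, -, ht₀⟩ := UpperSemicontinuousOn.exists_isMaxOn (f := r) Set.univ_nonempty
    isCompact_univ (hr.upperSemicontinuousOn _)
  set M := r t₀
  have hM : ∀ t, r t ≤ M := fun t => ht₀ (Set.mem_univ t)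
  have hlayer : ∀ π : Measure T, ∫⁻ t, r t ∂π
      = ∫⁻ s in Set.Ioi (0 : ℝ), π {t | s ≤ (r t).toReal} := fun π => by
    rw [← lintegral_eq_lintegral_meas_le π (ae_of_all _ fun t => ENNReal.toReal_nonneg)
      hr.measurable.ennreal_toReal.aemeasurable]
    exact lintegral_congr fun t => (ENNReal.ofReal_toReal (hfin t).ne).symm
  have hset : ∀ s : ℝ, 0 < s → {t | s ≤ (r t).toReal} = r ⁻¹' Set.Ici (ENNReal.ofReal s) :=
    fun s hs => by
      ext t
      simp [ENNReal.ofReal_le_iff_le_toReal (hfin t).ne]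
  refine IsSeqClosed.isClosed fun π π₀ hπ hlim => ?_
  simp only [Set.mem_ofPred_eq] at hπ ⊢
  calc c ≤ limsup (fun n => ∫⁻ t, r t ∂(π n : Measure T)) atTop :=
        le_limsup_of_frequently_le (Frequently.of_forall hπ)
    _ = limsup (fun n => ∫⁻ s in Set.Ioi (0 : ℝ),
          (π n : Measure T) {t | s ≤ (r t).toReal}) atTop := by simp only [hlayer]
    _ ≤ ∫⁻ s in Set.Ioi (0 : ℝ),
          limsup (fun n => (π n : Measure T) {t | s ≤ (r t).toReal}) atTop := by
        refine limsup_lintegral_le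
          ((Set.Iic M.toReal).indicator fun _ => 1) (fun n => ?_) (fun n => ?_) ?_
        · exact Antitone.measurable fun s s' hss =>
            measure_mono fun t (ht : s' ≤ _) => hss.trans ht
        · refine ae_of_all _ fun s => ?_
          by_cases hs : s ≤ M.toReal
          · simpa [Set.indicator, hs] using prob_le_one
          · have : {t | s ≤ (r t).toReal} = ∅ := by
              ext t
              simpa using lt_of_le_of_lt (ENNReal.toReal_mono (hfin t₀).ne (hM t)) (not_le.1 hs)
            simp [this]
        · rw [lintegral_indicator measurableSet_Iic, Measure.restrict_restrict measurableSet_Iic]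
          simp [Set.Iic_inter_Ioi]
    _ ≤ ∫⁻ s in Set.Ioi (0 : ℝ), (π₀ : Measure T) {t | s ≤ (r t).toReal} := by
        refine setLIntegral_mono' measurableSet_Ioi fun s hs => ?_
        refine ProbabilityMeasure.limsup_measure_closed_le_of_tendsto hlim ?_
        rw [hset s hs]
        exact hr.isClosed_preimage _
    _ = ∫⁻ t, r t ∂(π₀ : Measure T) := (hlayer _).symm

namespace ProbabilityTheory.Kernel

variable {X A : Type*} [MeasurableSpace X] [MeasurableSpace A]

/-- The mixture of finitely many kernels with constant weights. -/
noncomputable def mixture {ι : Type*} [Fintype ι] (c : ι → ENNReal) (δ : ι → Kernel X A) :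
    Kernel X A where
  toFun x := ∑ i, c i • δ i x
  measurable' := by
    refine Measure.measurable_of_measurable_coe _ fun s hs => ?_
    simp only [Measure.coe_finsetSum, Finset.sum_apply, Measure.smul_apply, smul_eq_mul]
    exact Finset.measurable_sum _ fun i _ => ((δ i).measurable_coe hs).const_mul _

lemma isMarkovKernel_mixture {ι : Type*} [Fintype ι] {c : ι → ENNReal} (hc : ∑ i, c i = 1)
    (δ : ι → Kernel X A) [∀ i, IsMarkovKernel (δ i)] : IsMarkovKernel (mixture c δ) :=
  ⟨fun x => ⟨by
    change (∑ i, c i • δ i x) Set.univ = 1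
    simp [hc]⟩⟩

/-- The kernel that accepts the action drawn from `δ` with probability `w`, and otherwise draws
a new action from `δ'`. -/
noncomputable def thinning {w : A → ENNReal} (hw : Measurable w) (δ δ' : Kernel X A) :
    Kernel X A where
  toFun x := (δ x).withDensity w + (∫⁻ a, (1 - w a) ∂(δ x)) • δ' x
  measurable' := by
    refine Measure.measurable_of_measurable_coe _ fun s hs => ?_
    simp only [Measure.add_apply, Measure.smul_apply, smul_eq_mul, withDensity_apply _ hs,
      ← lintegral_indicator hs]
    exact (hw.indicator hs).lintegral_kernel.add
      ((Measurable.lintegral_kernel (measurable_const.sub hw)).mul (δ'.measurable_coe hs))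

lemma isMarkovKernel_thinning {w : A → ENNReal} (hw : Measurable w) (hw1 : ∀ a, w a ≤ 1)
    (δ δ' : Kernel X A) [IsMarkovKernel δ] [IsMarkovKernel δ'] :
    IsMarkovKernel (thinning hw δ δ') :=
  ⟨fun x => ⟨by
    change ((δ x).withDensity w + (∫⁻ a, (1 - w a) ∂(δ x)) • δ' x) Set.univ = 1
    simp only [Measure.add_apply, Measure.smul_apply, smul_eq_mul,
      withDensity_apply _ MeasurableSet.univ, Measure.restrict_univ, measure_univ, mul_one]
    rw [← lintegral_add_left hw]
    simp [add_tsub_cancel_of_le (hw1 _)]⟩⟩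

end ProbabilityTheory.Kernel

section Risk

variable {Θ X A : Type*} [MeasurableSpace X] [MeasurableSpace A]
  {ℓ : Θ → A → NNReal} {P : Θ → Measure X}

lemma risk_mixture (hℓ : ∀ θ, Measurable (ℓ θ)) {ι : Type*} [Fintype ι] (c : ι → ENNReal)
    (δ : ι → Kernel X A) (θ : Θ) :
    risk ℓ P (Kernel.mixture c δ) θ = ∑ i, c i * risk ℓ P (δ i) θ := by
  have hm : ∀ i, Measurable fun x => ∫⁻ a, (ℓ θ a : ENNReal) ∂(δ i x) := fun i =>
    (hℓ θ).coe_nnreal_ennreal.lintegral_kernel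
  change ∫⁻ x, ∫⁻ a, (ℓ θ a : ENNReal) ∂(∑ i, c i • δ i x) ∂(P θ) = _
  simp only [lintegral_finsetSum_measure, lintegral_smul_measure, smul_eq_mul]
  rw [lintegral_finsetSum _ fun i _ => (hm i).const_mul _]
  exact Finset.sum_congr rfl fun i _ => lintegral_const_mul _ (hm i)

lemma risk_thinning (hℓ : ∀ θ, Measurable (ℓ θ)) {w : A → ENNReal} (hw : Measurable w)
    (δ δ' : Kernel X A) (θ : Θ) :
    risk ℓ P (Kernel.thinning hw δ δ') θ
      = ∫⁻ x, ∫⁻ a, w a * ℓ θ a ∂(δ x) ∂(P θ)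
        + ∫⁻ x, (∫⁻ a, (1 - w a) ∂(δ x)) * ∫⁻ a, (ℓ θ a : ENNReal) ∂(δ' x) ∂(P θ) := by
  have hm := (hℓ θ).coe_nnreal_ennreal
  change ∫⁻ x, ∫⁻ a, (ℓ θ a : ENNReal)
    ∂((δ x).withDensity w + (∫⁻ a, (1 - w a) ∂(δ x)) • δ' x) ∂(P θ) = _
  simp only [lintegral_add_measure, lintegral_smul_measure, smul_eq_mul,
    lintegral_withDensity_eq_lintegral_mul _ hw hm]
  rw [lintegral_add_left]
  · rfl
  · exact (hw.mul hm).lintegral_kernel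

lemma lintegral_rejection_mul_le (w : A → ENNReal) (δ δ' : Kernel X A) [IsMarkovKernel δ] (θ : Θ) :
    ∫⁻ x, (∫⁻ a, (1 - w a) ∂(δ x)) * ∫⁻ a, (ℓ θ a : ENNReal) ∂(δ' x) ∂(P θ)
      ≤ risk ℓ P δ' θ := by
  refine lintegral_mono fun x => mul_le_of_le_one_left' ?_
  calc ∫⁻ a, (1 - w a) ∂(δ x) ≤ ∫⁻ _, 1 ∂(δ x) := lintegral_mono fun a => tsub_le_self
    _ = 1 := by simp

lemma risk_thinning_lt_top (hℓ : ∀ θ, Measurable (ℓ θ)) {w : A → ENNReal} (hw : Measurable w)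
    {δ δ' : Kernel X A} [IsMarkovKernel δ] {θ : Θ} (hδ' : risk ℓ P δ' θ < ⊤)
    (hδ : ∫⁻ x, ∫⁻ a, w a * ℓ θ a ∂(δ x) ∂(P θ) < ⊤) :
    risk ℓ P (Kernel.thinning hw δ δ') θ < ⊤ := by
  rw [risk_thinning hℓ]
  exact ENNReal.add_lt_top.2 ⟨hδ, (lintegral_rejection_mul_le w δ δ' θ).trans_lt hδ'⟩

/-- Under upper semicontinuity of all risk functions on a compact parameter space, every
procedure admits a single positive acceptance weight making its weighted loss integrable at
every parameter. -/
lemma exists_weight_lintegral_lt_top [TopologicalSpace Θ] [CompactSpace Θ]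
    (hℓ : ∀ θ, Measurable (ℓ θ)) (hP : ∀ θ, IsProbabilityMeasure (P θ))
    (husc : ∀ δ : Kernel X A, IsMarkovKernel δ → UpperSemicontinuous fun θ => risk ℓ P δ θ)
    (δ δ' : Kernel X A) [IsMarkovKernel δ] [IsMarkovKernel δ']
    (hδ' : ∀ θ, risk ℓ P δ' θ < ⊤) :
    ∃ w : A → ENNReal, Measurable w ∧ (∀ a, w a ≠ 0) ∧
      ∀ θ, ∫⁻ x, ∫⁻ a, w a * ℓ θ a ∂(δ x) ∂(P θ) < ⊤ := by
  have hmeas : ∀ t : Finset Θ, Measurable fun a => (1 + ∑ θ ∈ t, (ℓ θ a : ENNReal))⁻¹ := fun t =>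
    (measurable_const.add (Finset.measurable_sum _ fun θ _ => (hℓ θ).coe_nnreal_ennreal)).inv
  have hnhds : ∀ θ, ∀ᶠ θ' in 𝓝 θ,
      ∫⁻ x, ∫⁻ a, (1 + (ℓ θ a : ENNReal))⁻¹ * ℓ θ' a ∂(δ x) ∂(P θ') < ⊤ := by
    intro θ
    have hwm : Measurable fun a => (1 + (ℓ θ a : ENNReal))⁻¹ := by simpa using hmeas {θ}
    have hM : IsMarkovKernel (Kernel.thinning hwm δ δ') :=
      Kernel.isMarkovKernel_thinning hwm (fun a => by simp) δ δ'
    have hθ : risk ℓ P (Kernel.thinning hwm δ δ') θ < ⊤ := by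
      refine risk_thinning_lt_top hℓ hwm (hδ' θ) (lt_of_le_of_lt ?_ ENNReal.one_lt_top)
      calc ∫⁻ x, ∫⁻ a, (1 + (ℓ θ a : ENNReal))⁻¹ * ℓ θ a ∂(δ x) ∂(P θ)
          ≤ ∫⁻ x, ∫⁻ _, 1 ∂(δ x) ∂(P θ) := by
            refine lintegral_mono fun x => lintegral_mono fun a => ?_
            rw [mul_comm, ← div_eq_mul_inv]
            exact ENNReal.div_le_of_le_mul (by simp)
        _ = 1 := by simp
    filter_upwards [husc _ hM θ ⊤ hθ] with θ' hθ'
    rw [risk_thinning hℓ] at hθ'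
    exact (ENNReal.add_lt_top.1 hθ').1
  obtain ⟨t, -, ht⟩ := isCompact_univ.elim_nhds_subcover _ fun θ _ => hnhds θ
  refine ⟨fun a => (1 + ∑ θ ∈ t, (ℓ θ a : ENNReal))⁻¹, hmeas t, fun a => ?_, fun θ => ?_⟩
  · exact ENNReal.inv_ne_zero.2 (by simp [ENNReal.sum_eq_top])
  · obtain ⟨θ', hθ't, hθ'⟩ := Set.mem_iUnion₂.1 (ht (Set.mem_univ θ))
    refine lt_of_le_of_lt (lintegral_mono fun x => lintegral_mono fun a => ?_) hθ'
    change (1 + ∑ θ ∈ t, (ℓ θ a : ENNReal))⁻¹ * _ ≤ _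
    gcongr
    exact Finset.single_le_sum (f := fun θ => (ℓ θ a : ENNReal)) (fun _ _ => zero_le) hθ't

/-- A lower bound for the Bayes risk over procedures of finite risk extends to all procedures. -/
lemma le_lintegral_risk_of_forall_lt_top [TopologicalSpace Θ] [CompactSpace Θ]
    [MeasurableSpace Θ] [BorelSpace Θ]
    (hℓ : ∀ θ, Measurable (ℓ θ)) (hP : ∀ θ, IsProbabilityMeasure (P θ))
    (husc : ∀ δ : Kernel X A, IsMarkovKernel δ → UpperSemicontinuous fun θ => risk ℓ P δ θ)
    {δ' : Kernel X A} [IsMarkovKernel δ'] {M : ENNReal} (hM : M < ⊤)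
    (hδ' : ∀ θ, risk ℓ P δ' θ ≤ M) {π : Measure Θ} [IsProbabilityMeasure π] {V : ENNReal}
    (hV : ∀ δ : Kernel X A, IsMarkovKernel δ → (∀ θ, risk ℓ P δ θ < ⊤) →
      V ≤ ∫⁻ θ, risk ℓ P δ θ ∂π)
    (δ : Kernel X A) [IsMarkovKernel δ] : V ≤ ∫⁻ θ, risk ℓ P δ θ ∂π := by
  rcases eq_or_ne (∫⁻ θ, risk ℓ P δ θ ∂π) ⊤ with htop | htop
  · simp [htop]
  have hfin' : ∀ θ, risk ℓ P δ' θ < ⊤ := fun θ => (hδ' θ).trans_lt hM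
  obtain ⟨w, hwm, hw0, hw⟩ := exists_weight_lintegral_lt_top hℓ hP husc δ δ' hfin'
  set v : ℕ → A → ENNReal := fun n a => min 1 (n * w a)
  have hvm : ∀ n, Measurable (v n) := fun n => measurable_const.min (hwm.const_mul _)
  have hv1 : ∀ n a, v n a ≤ 1 := fun n a => min_le_left _ _
  have hvev : ∀ a, ∀ᶠ n in atTop, v n a = 1 := fun a => by
    obtain ⟨N, hN⟩ := ENNReal.exists_nat_mul_gt (hw0 a) ENNReal.one_ne_top
    filter_upwards [eventually_ge_atTop N] with n hn
    refine min_eq_left (hN.le.trans ?_)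
    gcongr
  have hmark : ∀ n, IsMarkovKernel (Kernel.thinning (hvm n) δ δ') := fun n =>
    Kernel.isMarkovKernel_thinning (hvm n) (hv1 n) δ δ'
  have hacc : ∀ n θ, ∫⁻ x, ∫⁻ a, v n a * ℓ θ a ∂(δ x) ∂(P θ) ≤ risk ℓ P δ θ := fun n θ =>
    lintegral_mono fun x => lintegral_mono fun a => mul_le_of_le_one_left' (hv1 n a)
  have hVn : ∀ n, V ≤ ∫⁻ θ, risk ℓ P (Kernel.thinning (hvm n) δ δ') θ ∂π := fun n => by
    refine hV _ (hmark n) fun θ => risk_thinning_lt_top hℓ _ (hfin' θ) ?_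
    calc ∫⁻ x, ∫⁻ a, v n a * ℓ θ a ∂(δ x) ∂(P θ)
        ≤ ∫⁻ x, ∫⁻ a, n * (w a * ℓ θ a) ∂(δ x) ∂(P θ) := by
          refine lintegral_mono fun x => lintegral_mono fun a => ?_
          rw [← mul_assoc]
          gcongr
          exact min_le_right _ _
      _ = n * ∫⁻ x, ∫⁻ a, w a * ℓ θ a ∂(δ x) ∂(P θ) := by
          have h1 : Measurable fun a => w a * (ℓ θ a : ENNReal) :=
            hwm.mul (hℓ θ).coe_nnreal_ennreal
          simp only [lintegral_const_mul _ h1]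
          exact lintegral_const_mul _ h1.lintegral_kernel
      _ < ⊤ := ENNReal.mul_lt_top (by simp) (hw θ)
  have hrej : ∀ θ, Tendsto (fun n => ∫⁻ x, (∫⁻ a, (1 - v n a) ∂(δ x)) *
      ∫⁻ a, (ℓ θ a : ENNReal) ∂(δ' x) ∂(P θ)) atTop (𝓝 0) := by
    intro θ
    have hL : Measurable fun x => ∫⁻ a, (ℓ θ a : ENNReal) ∂(δ' x) :=
      (hℓ θ).coe_nnreal_ennreal.lintegral_kernel
    rw [← lintegral_zero (μ := P θ)]
    refine tendsto_lintegral_of_dominated_convergence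
      (fun x => ∫⁻ a, (ℓ θ a : ENNReal) ∂(δ' x)) (fun n => ?_) (fun n => ?_) (hfin' θ).ne ?_
    · exact (measurable_const.sub (hvm n)).lintegral_kernel.mul hL
    · refine ae_of_all _ fun x => mul_le_of_le_one_left' ?_
      calc ∫⁻ a, (1 - v n a) ∂(δ x) ≤ ∫⁻ _, 1 ∂(δ x) := lintegral_mono fun a => tsub_le_self
        _ = 1 := by simp
    · filter_upwards [ae_lt_top hL (hfin' θ).ne] with x hx
      have h0 : Tendsto (fun n => ∫⁻ a, (1 - v n a) ∂(δ x)) atTop (𝓝 0) := by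
        rw [← lintegral_zero (μ := δ x)]
        refine tendsto_lintegral_of_dominated_convergence (fun _ => 1)
          (fun n => measurable_const.sub (hvm n)) (fun n => ae_of_all _ fun a => tsub_le_self)
          (by simp) (ae_of_all _ fun a => ?_)
        refine tendsto_const_nhds.congr' ?_
        filter_upwards [hvev a] with n hn
        simp [hn]
      simpa using ENNReal.Tendsto.mul_const h0 (Or.inr hx.ne)
  calc V ≤ limsup (fun n => ∫⁻ θ, risk ℓ P (Kernel.thinning (hvm n) δ δ') θ ∂π) atTop :=
        le_limsup_of_frequently_le (Frequently.of_forall hVn)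
    _ ≤ ∫⁻ θ, limsup (fun n => risk ℓ P (Kernel.thinning (hvm n) δ δ') θ) atTop ∂π := by
        refine limsup_lintegral_le (fun θ => risk ℓ P δ θ + M)
          (fun n => (husc _ (hmark n)).measurable) (fun n => ae_of_all _ fun θ => ?_) ?_
        · simp only [risk_thinning hℓ]
          exact add_le_add (hacc n θ) ((lintegral_rejection_mul_le _ δ δ' θ).trans (hδ' θ))
        · rw [lintegral_add_right _ measurable_const]
          simp [htop, hM.ne]
    _ ≤ ∫⁻ θ, risk ℓ P δ θ ∂π := by
        refine lintegral_mono fun θ => ?_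
        have hlim := (tendsto_const_nhds (x := risk ℓ P δ θ)).add (hrej θ)
        rw [add_zero] at hlim
        refine le_of_le_of_eq (limsup_le_limsup (Eventually.of_forall fun n => ?_)) hlim.limsup_eq
        simp only [risk_thinning hℓ]
        gcongr
        exact hacc n θ

/-- Any finite family of finite-risk procedures has Bayes risks above a given level below the
minimax value for a common prior. -/
lemma exists_prior_forall_le_lintegral_risk [TopologicalSpace Θ] [Nonempty Θ]
    [MeasurableSpace Θ] [BorelSpace Θ] (hℓ : ∀ θ, Measurable (ℓ θ))
    (husc : ∀ δ : Kernel X A, IsMarkovKernel δ → UpperSemicontinuous fun θ => risk ℓ P δ θ)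
    {ι : Type*} [Fintype ι] (δ : ι → Kernel X A) [∀ i, IsMarkovKernel (δ i)]
    (hδ : ∀ i θ, risk ℓ P (δ i) θ < ⊤) {c : NNReal}
    (hc : ∀ δ : Kernel X A, IsMarkovKernel δ → c < ⨆ θ, risk ℓ P δ θ) :
    ∃ π : Measure Θ, IsProbabilityMeasure π ∧ ∀ i, c ≤ ∫⁻ θ, risk ℓ P (δ i) θ ∂π := by
  obtain ⟨v, hv, hcv⟩ := exists_mem_convexHull_range_forall_lt
    (fun i θ => (risk ℓ P (δ i) θ).toReal) c fun l hl hl1 => by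
      have hM := Kernel.isMarkovKernel_mixture (c := fun i => ENNReal.ofReal (l i))
        (by rw [← ENNReal.ofReal_sum_of_nonneg fun i _ => hl i, hl1, ENNReal.ofReal_one]) δ
      obtain ⟨θ, hθ⟩ := lt_iSup_iff.1 (hc _ hM)
      refine ⟨θ, ?_⟩
      have heq : risk ℓ P (Kernel.mixture (fun i => ENNReal.ofReal (l i)) δ) θ
          = ENNReal.ofReal (∑ i, l i * (risk ℓ P (δ i) θ).toReal) := by
        rw [risk_mixture hℓ, ENNReal.ofReal_sum_of_nonneg fun i _ =>
          mul_nonneg (hl i) ENNReal.toReal_nonneg]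
        refine Finset.sum_congr rfl fun i _ => ?_
        rw [ENNReal.ofReal_mul (hl i), ENNReal.ofReal_toReal (hδ i θ).ne]
      rw [heq, ← ENNReal.ofReal_coe_nnreal] at hθ
      exact (ENNReal.ofReal_lt_ofReal_iff_of_nonneg c.2).1 hθ
  obtain ⟨π, hπ, hle⟩ := exists_isProbabilityMeasure_of_mem_convexHull _
    (fun i => (husc (δ i) inferInstance).measurable.ennreal_toReal) hv
  refine ⟨π, hπ, fun i => ?_⟩
  calc (c : ENNReal) = ENNReal.ofReal c := ENNReal.ofReal_coe_nnreal.symm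
    _ ≤ ENNReal.ofReal (v i) := ENNReal.ofReal_le_ofReal (hcv i).le
    _ ≤ _ := hle i
    _ = _ := lintegral_congr fun θ => ENNReal.ofReal_toReal (hδ i θ).ne

/-- There is a prior under which every finite-risk procedure has Bayes risk at least `V`,
as soon as every procedure has worst-case risk at least `V`. -/
lemma exists_prior_forall_lt_top_le_lintegral_risk [MetricSpace Θ] [CompactSpace Θ] [Nonempty Θ]
    [MeasurableSpace Θ] [BorelSpace Θ] (hℓ : ∀ θ, Measurable (ℓ θ))
    (husc : ∀ δ : Kernel X A, IsMarkovKernel δ → UpperSemicontinuous fun θ => risk ℓ P δ θ)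
    {V : ENNReal} (hV : ∀ δ : Kernel X A, IsMarkovKernel δ → V ≤ ⨆ θ, risk ℓ P δ θ) :
    ∃ π : Measure Θ, IsProbabilityMeasure π ∧
      ∀ δ : Kernel X A, IsMarkovKernel δ → (∀ θ, risk ℓ P δ θ < ⊤) →
        V ≤ ∫⁻ θ, risk ℓ P δ θ ∂π := by
  classical
  let ι := {δ : Kernel X A // IsMarkovKernel δ ∧ ∀ θ, risk ℓ P δ θ < ⊤} × {c : NNReal // c < V}
  obtain ⟨π, hπ⟩ := CompactSpace.iInter_nonempty
    (t := fun i : ι => {π : ProbabilityMeasure Θ |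
      (i.2.1 : ENNReal) ≤ ∫⁻ θ, risk ℓ P i.1.1 θ ∂(π : Measure Θ)})
    (fun i => isClosed_setOf_le_lintegral_of_upperSemicontinuous _ (husc _ i.1.2.1) i.1.2.2 _)
    fun u => by
      rcases u.eq_empty_or_nonempty with rfl | ⟨i₀, hi₀⟩
      · exact ⟨⟨Measure.dirac (Classical.arbitrary Θ), inferInstance⟩, Set.mem_iInter₂.2 fun i hi => by simp at hi⟩
      obtain ⟨j, -, hj⟩ := u.exists_max_image (fun i => i.2.1) ⟨i₀, hi₀⟩
      have : ∀ i : u, IsMarkovKernel i.1.1.1 := fun i => i.1.1.2.1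
      obtain ⟨π, hπ, hle⟩ := exists_prior_forall_le_lintegral_risk hℓ husc
        (fun i : u => i.1.1.1) (fun i => i.1.1.2.2) (c := j.2.1)
        fun δ hδ => j.2.2.trans_le (hV δ hδ)
      refine ⟨⟨π, hπ⟩, Set.mem_iInter₂.2 fun i hi => ?_⟩
      exact (ENNReal.coe_le_coe.2 (hj i hi)).trans (hle ⟨i, hi⟩)
  refine ⟨π, inferInstance, fun δ hδ hfin => ENNReal.le_of_forall_nnreal_lt fun c hc => ?_⟩
  exact Set.mem_iInter.1 hπ (⟨δ, hδ, hfin⟩, ⟨c, hc⟩)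

end Risk

/-- On a compact metric parameter space with upper semicontinuous risk functions and finite
minimax value, there is a least favorable prior `π₀`, and every minimax decision procedure
is Bayes with respect to `π₀`. -/
theorem stmt8 {Θ X A : Type*} [MetricSpace Θ] [CompactSpace Θ] [Nonempty Θ]
    [MeasurableSpace Θ] [BorelSpace Θ] [MeasurableSpace X] [MeasurableSpace A]
    (ℓ : Θ → A → NNReal) (hℓ : ∀ θ : Θ, Measurable (ℓ θ))
    (P : Θ → Measure X) (hP : ∀ θ : Θ, IsProbabilityMeasure (P θ))
    (hfin : (⨅ δ : {δ : Kernel X A // IsMarkovKernel δ}, ⨆ θ : Θ, risk ℓ P δ.1 θ) < ⊤)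
    (husc : ∀ δ : Kernel X A, IsMarkovKernel δ →
      UpperSemicontinuous (fun θ : Θ => risk ℓ P δ θ)) :
    ∃ π₀ : Measure Θ, IsProbabilityMeasure π₀ ∧
      (⨅ δ : {δ : Kernel X A // IsMarkovKernel δ}, ∫⁻ θ, risk ℓ P δ.1 θ ∂π₀)
        = (⨆ π : {π : Measure Θ // IsProbabilityMeasure π},
            ⨅ δ : {δ : Kernel X A // IsMarkovKernel δ}, ∫⁻ θ, risk ℓ P δ.1 θ ∂π.1) ∧
      ∀ δ₀ : Kernel X A, IsMarkovKernel δ₀ →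
        (⨆ θ : Θ, risk ℓ P δ₀ θ)
          = (⨅ δ : {δ : Kernel X A // IsMarkovKernel δ}, ⨆ θ : Θ, risk ℓ P δ.1 θ) →
        (∫⁻ θ, risk ℓ P δ₀ θ ∂π₀)
          = (⨅ δ : {δ : Kernel X A // IsMarkovKernel δ}, ∫⁻ θ, risk ℓ P δ.1 θ ∂π₀) := by
  obtain ⟨⟨δ', hδ'⟩, hlt⟩ := iInf_lt_iff.1 hfin
  obtain ⟨π₀, hπ₀, hle⟩ := exists_prior_forall_lt_top_le_lintegral_risk hℓ husc
    fun δ hδ => iInf_le (fun δ : {δ : Kernel X A // IsMarkovKernel δ} =>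
      ⨆ θ : Θ, risk ℓ P δ.1 θ) ⟨δ, hδ⟩
  have hsup : ∀ (π : Measure Θ) [IsProbabilityMeasure π] (δ : Kernel X A),
      ∫⁻ θ, risk ℓ P δ θ ∂π ≤ ⨆ θ, risk ℓ P δ θ := fun π _ δ =>
    (lintegral_mono fun θ => le_iSup (risk ℓ P δ) θ).trans (by simp)
  have hbayes : (⨅ δ : {δ : Kernel X A // IsMarkovKernel δ}, ⨆ θ : Θ, risk ℓ P δ.1 θ)
      ≤ ⨅ δ : {δ : Kernel X A // IsMarkovKernel δ}, ∫⁻ θ, risk ℓ P δ.1 θ ∂π₀ :=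
    le_iInf fun ⟨δ, hδ⟩ => le_lintegral_risk_of_forall_lt_top hℓ hP husc hlt
      (fun θ => le_iSup (risk ℓ P δ') θ) hle δ
  refine ⟨π₀, hπ₀, le_antisymm ?_ ?_, fun δ₀ hδ₀ hmin => le_antisymm ?_ ?_⟩
  · exact le_iSup (fun π : {π : Measure Θ // IsProbabilityMeasure π} =>
      ⨅ δ : {δ : Kernel X A // IsMarkovKernel δ}, ∫⁻ θ, risk ℓ P δ.1 θ ∂π.1) ⟨π₀, hπ₀⟩
  · exact iSup_le fun ⟨π, hπ⟩ => (iInf_mono fun δ : {δ : Kernel X A // IsMarkovKernel δ} =>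
      hsup π δ.1).trans hbayes
  · exact (hsup π₀ δ₀).trans (hmin.le.trans hbayes)
  · exact iInf_le (fun δ : {δ : Kernel X A // IsMarkovKernel δ} =>
      ∫⁻ θ, risk ℓ P δ.1 θ ∂π₀) ⟨δ₀, hδ₀⟩
end

section
/- Minimax theorem on totally bounded parameter spaces with Lipschitz risks: suppose Θ is a nonempty totally bounded metric space with its Borel σ-algebra, A is nonempty, and there exists k ≥ 0 such that for every δ ∈ 𝒟 the risk function θ ↦ r(θ,δ) is a real-valued (finite) function that is Lipschitz with constant k on Θ. Then inf_{δ ∈ 𝒟} sup_{θ ∈ Θ} r(θ,δ) = sup_{π} inf_{δ ∈ 𝒟} ∫_Θ r(θ,δ) π(dθ), where π ranges over all countably additive Borel probability measures on Θ. -/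
open MeasureTheory ProbabilityTheory

/-- The convex combination of two Markov kernels is a Markov kernel. -/
theorem exists_markovKernel_convexComb {X A : Type*} [MeasurableSpace X] [MeasurableSpace A]
    (δ₁ δ₂ : Kernel X A) (h₁ : IsMarkovKernel δ₁) (h₂ : IsMarkovKernel δ₂) (a b : NNReal)
    (hab : a + b = 1) :
    ∃ δ : Kernel X A, IsMarkovKernel δ ∧
      ∀ x, δ x = (a : ENNReal) • δ₁ x + (b : ENNReal) • δ₂ x := by
  refine ⟨⟨fun x => (a : ENNReal) • δ₁ x + (b : ENNReal) • δ₂ x, ?_⟩, ⟨fun x => ⟨?_⟩⟩, fun x => rfl⟩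
  · refine Measure.measurable_of_measurable_coe _ fun s hs => ?_
    simp only [Measure.add_apply, Measure.smul_apply, smul_eq_mul]
    exact ((δ₁.measurable_coe hs).const_mul _).add ((δ₂.measurable_coe hs).const_mul _)
  · change ((a : ENNReal) • δ₁ x + (b : ENNReal) • δ₂ x) Set.univ = 1
    simp only [Measure.add_apply, Measure.smul_apply, smul_eq_mul, measure_univ, mul_one]
    exact_mod_cast hab

theorem risk_convexComb {Θ X A : Type*} [MeasurableSpace X] [MeasurableSpace A]
    (ℓ : Θ → A → NNReal) (hℓ : ∀ θ : Θ, Measurable (ℓ θ)) (P : Θ → Measure X)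
    (δ₁ δ₂ δ : Kernel X A) (a b : ENNReal) (h : ∀ x, δ x = a • δ₁ x + b • δ₂ x) (θ : Θ) :
    risk ℓ P δ θ = a * risk ℓ P δ₁ θ + b * risk ℓ P δ₂ θ := by
  have hm : ∀ κ : Kernel X A, Measurable fun x => ∫⁻ c, (ℓ θ c : ENNReal) ∂(κ x) := fun κ =>
    (hℓ θ).coe_nnreal_ennreal.lintegral_kernel
  simp only [risk, h, lintegral_add_measure, lintegral_smul_measure, smul_eq_mul]
  rw [lintegral_add_left ((hm δ₁).const_mul a), lintegral_const_mul _ (hm δ₁),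
    lintegral_const_mul _ (hm δ₂)]

/-- A convex set of payoff vectors each having some coordinate at least `c` admits a mixed
strategy guaranteeing `c`. -/
theorem Convex.exists_weights_le_sum {T : Type*} [Fintype T] {C : Set (T → ℝ)}
    (hC : Convex ℝ C) (hne : C.Nonempty) (c : ℝ) (h : ∀ y ∈ C, ∃ t, c ≤ y t) :
    ∃ w : T → ℝ, (∀ t, 0 ≤ w t) ∧ ∑ t, w t = 1 ∧ ∀ y ∈ C, c ≤ ∑ t, w t * y t := by
  classical
  have hs : Convex ℝ (Set.univ.pi fun _ : T => Set.Iio c) := convex_pi fun _ _ => convex_Iio c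
  have ho : IsOpen (Set.univ.pi fun _ : T => Set.Iio c) :=
    isOpen_set_pi Set.finite_univ fun _ _ => isOpen_Iio
  have hd : Disjoint (Set.univ.pi fun _ : T => Set.Iio c) C := by
    refine Set.disjoint_left.2 fun y hy hyC => ?_
    obtain ⟨t, ht⟩ := h y hyC
    exact absurd (hy t trivial) (not_lt.2 ht)
  obtain ⟨L, u, hLs, hLC⟩ := geometric_hahn_banach_open hs ho hC hd
  set w : T → ℝ := fun t => L (Pi.single t 1) with hw
  have hL : ∀ y : T → ℝ, L y = ∑ t, w t * y t := fun y => by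
    conv_lhs => rw [← Finset.univ_sum_single y]
    rw [map_sum]
    refine Finset.sum_congr rfl fun t _ => ?_
    have : Pi.single t (y t) = y t • (Pi.single t 1 : T → ℝ) := by
      rw [← Pi.single_smul, smul_eq_mul, mul_one]
    rw [this, map_smul, smul_eq_mul, mul_comm]
  have hconst : ∀ r, L (fun _ => r) = (∑ t, w t) * r := fun r => by
    rw [hL, Finset.sum_mul]
  have hw0 : ∀ t, 0 ≤ w t := by
    intro t
    by_contra! hneg
    obtain ⟨n, hn⟩ := exists_nat_gt ((u - L (fun _ => c - 1)) / (-w t))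
    rw [div_lt_iff₀ (by linarith)] at hn
    have := hLs ((fun _ => c - 1) - (n : ℝ) • (Pi.single t 1 : T → ℝ)) (by
      intro s _
      have h0 : (0 : ℝ) ≤ (Pi.single t 1 : T → ℝ) s := by
        by_cases hst : s = t
        · subst hst; simp
        · simp [hst]
      have : 0 ≤ (n : ℝ) * (Pi.single t 1 : T → ℝ) s := by positivity
      simp only [Pi.sub_apply, Pi.smul_apply, smul_eq_mul, Set.mem_Iio]
      linarith)
    rw [map_sub, map_smul, smul_eq_mul] at this
    change _ - (n : ℝ) * w t < u at this
    linarith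
  have hWlt : ∀ r < c, (∑ t, w t) * r < u := fun r hr => by
    rw [← hconst]
    exact hLs _ fun _ _ => hr
  have hW : 0 < ∑ t, w t := by
    refine lt_of_le_of_ne (Finset.sum_nonneg fun t _ => hw0 t) fun h0 => ?_
    have hz : ∀ t, w t = 0 := fun t =>
      (Finset.sum_eq_zero_iff_of_nonneg fun t _ => hw0 t).1 h0.symm t (Finset.mem_univ t)
    obtain ⟨y, hy⟩ := hne
    have h1 := hLC y hy
    have h2 := hWlt (c - 1) (by linarith)
    rw [hL] at h1
    simp only [hz, zero_mul, Finset.sum_const_zero] at h1 h2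
    linarith
  have hcu : c ≤ u / ∑ t, w t := by
    refine le_of_forall_lt fun r hr => ?_
    rw [lt_div_iff₀ hW, mul_comm]
    exact hWlt r hr
  refine ⟨fun t => w t / ∑ s, w s, fun t => div_nonneg (hw0 t) hW.le, ?_, fun y hy => ?_⟩
  · rw [← Finset.sum_div, div_self hW.ne']
  · refine hcu.trans ?_
    simp only [div_mul_eq_mul_div]
    rw [← Finset.sum_div, ← hL]
    exact div_le_div_of_nonneg_right (hLC y hy) hW.le

theorem exists_probabilityMeasure_integral_eq_sum {Θ : Type*} [MeasurableSpace Θ]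
    [MeasurableSingletonClass Θ] {T : Type*} [Fintype T] (p : T → Θ) (w : T → ℝ)
    (hw : ∀ t, 0 ≤ w t) (hw1 : ∑ t, w t = 1) :
    ∃ π : Measure Θ, IsProbabilityMeasure π ∧ ∀ f : Θ → ℝ, ∫ θ, f θ ∂π = ∑ t, w t * f (p t) := by
  refine ⟨∑ t, ENNReal.ofReal (w t) • Measure.dirac (p t), ⟨?_⟩, fun f => ?_⟩
  · simp [← ENNReal.ofReal_sum_of_nonneg fun t _ => hw t, hw1]
  · rw [integral_finsetSum_measure fun t _ =>
      (integrable_dirac (by simp)).smul_measure ENNReal.ofReal_ne_top]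
    simp [integral_smul_measure, ENNReal.toReal_ofReal (hw _)]

/-- Minimax theorem for a convex family of nonnegative, uniformly Lipschitz payoffs on a totally
bounded metric space. -/
theorem iInf_iSup_eq_iSup_iInf_integral {Θ ι : Type*} [MetricSpace Θ] [Nonempty Θ] [Nonempty ι]
    [MeasurableSpace Θ] [BorelSpace Θ] (hΘ : TotallyBounded (Set.univ : Set Θ))
    (f : ι → Θ → ℝ) (hf0 : ∀ i θ, 0 ≤ f i θ) (k : NNReal) (hLip : ∀ i, LipschitzWith k (f i))
    (hconv : Convex ℝ (Set.range f)) :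
    (⨅ i, ⨆ θ, f i θ)
      = ⨆ π : {π : Measure Θ // IsProbabilityMeasure π}, ⨅ i, ∫ θ, f i θ ∂π.1 := by
  have hbdd : ∀ i, BddAbove (Set.range (f i)) := fun i => by
    rw [← Set.image_univ]
    exact ((hΘ.image (hLip i).uniformContinuous).isBounded).bddAbove
  have hint : ∀ i (π : Measure Θ), IsProbabilityMeasure π → Integrable (f i) π := fun i π _ =>
    Integrable.of_bound (hLip i).continuous.measurable.aestronglyMeasurable (⨆ θ, f i θ)
      (.of_forall fun θ => by
        rw [Real.norm_of_nonneg (hf0 i θ)]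
        exact le_ciSup (hbdd i) θ)
  have hle : ∀ i (π : Measure Θ), IsProbabilityMeasure π → ∫ θ, f i θ ∂π ≤ ⨆ θ, f i θ :=
    fun i π hπ => by
      refine (integral_mono (hint i π hπ) (integrable_const _)
        fun θ => le_ciSup (hbdd i) θ).trans_eq ?_
      simp
  have hbelow : ∀ π : Measure Θ, BddBelow (Set.range fun i => ∫ θ, f i θ ∂π) := fun π =>
    ⟨0, by rintro _ ⟨i, rfl⟩; exact integral_nonneg (hf0 i)⟩
  have hle' : ∀ i (π : {π : Measure Θ // IsProbabilityMeasure π}),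
      (⨅ j, ∫ θ, f j θ ∂π.1) ≤ ⨆ θ, f i θ := fun i π =>
    (ciInf_le (hbelow π.1) i).trans (hle i π.1 π.2)
  have habove : BddAbove (Set.range fun π : {π : Measure Θ // IsProbabilityMeasure π} =>
      ⨅ j, ∫ θ, f j θ ∂π.1) := by
    obtain ⟨i⟩ := ‹Nonempty ι›
    exact ⟨_, by rintro _ ⟨π, rfl⟩; exact hle' i π⟩
  have : Nonempty {π : Measure Θ // IsProbabilityMeasure π} :=
    ⟨⟨Measure.dirac (Classical.arbitrary Θ), inferInstance⟩⟩
  refine le_antisymm (le_of_forall_pos_le_add fun ε hε => ?_)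
    (le_ciInf fun i => ciSup_le fun π => hle' i π)
  set V := ⨅ i, ⨆ θ, f i θ
  have hV : ∀ i, V ≤ ⨆ θ, f i θ := fun i =>
    ciInf_le ⟨0, by rintro _ ⟨i, rfl⟩; exact Real.iSup_nonneg (hf0 i)⟩ i
  obtain ⟨T, hT, hcov⟩ := Metric.totallyBounded_iff.1 hΘ (ε / 2 / (k + 1)) (by positivity)
  have := hT.fintype
  have hnet : ∀ i, ∃ t : T, V - ε ≤ f i t := fun i => by
    obtain ⟨θ, hθ⟩ := exists_lt_of_lt_ciSup (show V - ε / 2 < ⨆ θ, f i θ by linarith [hV i])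
    obtain ⟨t, ht, hθt⟩ := Set.mem_iUnion₂.1 (hcov (Set.mem_univ θ))
    refine ⟨⟨t, ht⟩, ?_⟩
    have h1 := (le_abs_self _).trans ((hLip i).dist_le_mul θ t)
    have h2 : (k : ℝ) * dist θ t ≤ ε / 2 := by
      have h3 := (lt_div_iff₀ (by positivity)).1 (Metric.mem_ball.1 hθt)
      nlinarith [dist_nonneg (x := θ) (y := t)]
    change V - ε ≤ f i t
    linarith
  have hC : Convex ℝ (Set.range fun i => fun t : T => f i t) := by
    have := hconv.linear_image (LinearMap.funLeft ℝ ℝ ((↑) : T → Θ))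
    rwa [← Set.range_comp] at this
  obtain ⟨w, hw0, hw1, hw⟩ := hC.exists_weights_le_sum (Set.range_nonempty _) (V - ε)
    (by rintro _ ⟨i, rfl⟩; exact hnet i)
  obtain ⟨π, hπ, hπf⟩ := exists_probabilityMeasure_integral_eq_sum ((↑) : T → Θ) w hw0 hw1
  have hVπ : V - ε ≤ ⨅ i, ∫ θ, f i θ ∂π := le_ciInf fun i => by
    rw [hπf]
    exact hw _ ⟨i, rfl⟩
  linarith [le_ciSup habove ⟨π, hπ⟩]

/-- Minimax theorem on a totally bounded metric parameter space: if all risk functions are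
real-valued and `k`-Lipschitz for a common `k ≥ 0`, then the minimax value equals the
maximin value over countably additive Borel priors. -/
theorem stmt12 {Θ X A : Type*} [MetricSpace Θ] [Nonempty Θ] [Nonempty A]
    [MeasurableSpace Θ] [BorelSpace Θ] [MeasurableSpace X] [MeasurableSpace A]
    (hΘ : TotallyBounded (Set.univ : Set Θ))
    (ℓ : Θ → A → NNReal) (hℓ : ∀ θ : Θ, Measurable (ℓ θ))
    (P : Θ → Measure X) (hP : ∀ θ : Θ, IsProbabilityMeasure (P θ))
    (k : NNReal)
    (hfin : ∀ δ : Kernel X A, IsMarkovKernel δ → ∀ θ : Θ, risk ℓ P δ θ ≠ ⊤)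
    (hLip : ∀ δ : Kernel X A, IsMarkovKernel δ →
      LipschitzWith k (fun θ : Θ => (risk ℓ P δ θ).toReal)) :
    (⨅ δ : {δ : Kernel X A // IsMarkovKernel δ}, ⨆ θ : Θ, (risk ℓ P δ.1 θ).toReal)
      = (⨆ π : {π : Measure Θ // IsProbabilityMeasure π},
          ⨅ δ : {δ : Kernel X A // IsMarkovKernel δ},
            ∫ θ, (risk ℓ P δ.1 θ).toReal ∂π.1) := by
  have : Nonempty {δ : Kernel X A // IsMarkovKernel δ} :=
    ⟨⟨Kernel.const X (Measure.dirac (Classical.arbitrary A)), inferInstance⟩⟩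
  refine iInf_iSup_eq_iSup_iInf_integral hΘ
    (fun (δ : {δ : Kernel X A // IsMarkovKernel δ}) θ => (risk ℓ P δ.1 θ).toReal)
    (fun _ _ => ENNReal.toReal_nonneg) k (fun δ => hLip δ.1 δ.2) ?_
  rintro _ ⟨δ₁, rfl⟩ _ ⟨δ₂, rfl⟩ a b ha hb hab
  lift a to NNReal using ha
  lift b to NNReal using hb
  obtain ⟨δ, hδ, h⟩ :=
    exists_markovKernel_convexComb δ₁.1 δ₂.1 δ₁.2 δ₂.2 a b (by exact_mod_cast hab)
  refine ⟨⟨δ, hδ⟩, funext fun θ => ?_⟩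
  change (risk ℓ P δ θ).toReal = (a : ℝ) * _ + (b : ℝ) * _
  rw [risk_convexComb ℓ hℓ P δ₁.1 δ₂.1 δ a b h,
    ENNReal.toReal_add (ENNReal.mul_ne_top ENNReal.coe_ne_top (hfin _ δ₁.2 θ))
      (ENNReal.mul_ne_top ENNReal.coe_ne_top (hfin _ δ₂.2 θ)),
    ENNReal.toReal_mul, ENNReal.toReal_mul, ENNReal.coe_toReal, ENNReal.coe_toReal]
end
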